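/- For |q|<1, the third-order mock theta functions satisfy ω(q) + 2ρ(q) = 3 J₆³/(J₂ J_{3,6}), where ω(q) = Σ_{n≥0} q^{2n(n+1)}/((q;q²)_{n+1})² and ρ(q) = Σ_{n≥0} q^{2n(n+1)} (q;q²)_{n+1}/(q³;q⁶)_{n+1}. -/

import Mathlib

open scoped BigOperators

noncomputable def poch (a q : ℂ) : ℂ := ∏' n : ℕ, (1 - a * q ^ n)

noncomputable def Jm (m : ℕ) (q : ℂ) : ℂ := poch (q ^ m) (q ^ m)

noncomputable def Jam (a m : ℕ) (q : ℂ) : ℂ :=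
  poch (q ^ a) (q ^ m) * poch (q ^ (m - a)) (q ^ m) * poch (q ^ m) (q ^ m)

noncomputable def Sser (a Q : ℂ) : ℂ :=
  ∑' n : ℕ, (1 / (1 - a * Q ^ n) - 1 / (1 - a⁻¹ * Q ^ (n + 1)))

noncomputable def pochN (a q : ℂ) (n : ℕ) : ℂ := ∏ k ∈ Finset.range n, (1 - a * q ^ k)

noncomputable def omega3 (q : ℂ) : ℂ :=
  ∑' n : ℕ, q ^ (2 * n * (n + 1)) / (pochN q (q ^ 2) (n + 1)) ^ 2

noncomputable def rho3 (q : ℂ) : ℂ :=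
  ∑' n : ℕ, q ^ (2 * n * (n + 1)) * pochN q (q ^ 2) (n + 1) / pochN (q ^ 3) (q ^ 6) (n + 1)

open Filter Topology Finset

lemma one_sub_pow_ne_zero_of_norm_lt_one {z : ℂ} (hz : ‖z‖ < 1) {n : ℕ} (hn : n ≠ 0) :
    1 - z ^ n ≠ 0 := by
  intro h
  have h1 : ‖z‖ ^ n < 1 := pow_lt_one₀ (norm_nonneg z) hz hn
  rw [← norm_pow, ← sub_eq_zero.mp h, norm_one] at h1
  exact lt_irrefl _ h1

/-- The finite `q`-Pochhammer symbol `(Q; Q)_n`. -/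
noncomputable def qfac (Q : ℂ) (n : ℕ) : ℂ := pochN Q Q n

lemma qfac_zero (Q : ℂ) : qfac Q 0 = 1 := by simp [qfac, pochN]

lemma qfac_succ (Q : ℂ) (n : ℕ) : qfac Q (n + 1) = qfac Q n * (1 - Q ^ (n + 1)) := by
  simp only [qfac, pochN, prod_range_succ]
  ring

lemma qfac_ne_zero {Q : ℂ} (hQ : ‖Q‖ < 1) (n : ℕ) : qfac Q n ≠ 0 := by
  induction n with
  | zero => simp [qfac_zero]
  | succ n ih =>
    rw [qfac_succ]
    exact mul_ne_zero ih (one_sub_pow_ne_zero_of_norm_lt_one hQ n.succ_ne_zero)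

/-- A form of the `q`-Chu–Vandermonde summation. -/
lemma sum_qfac_vandermonde {Q : ℂ} (hQ : ‖Q‖ < 1) (M k : ℕ) :
    ∑ m ∈ range (M + 1), Q ^ (m * (m + k)) / (qfac Q m * qfac Q (M - m) * qfac Q (m + k))
      = 1 / (qfac Q M * qfac Q (M + k)) := by
  induction M generalizing k with
  | zero => simp [qfac_zero]
  | succ M ih =>
    have hM := one_sub_pow_ne_zero_of_norm_lt_one hQ M.succ_ne_zero
    rw [← mul_right_inj' hM]
    have split : ∀ m ∈ range (M + 1 + 1), (1 - Q ^ (M + 1)) *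
        (Q ^ (m * (m + k)) / (qfac Q m * qfac Q (M + 1 - m) * qfac Q (m + k)))
        = (1 - Q ^ m) * (Q ^ (m * (m + k)) /
            (qfac Q m * qfac Q (M + 1 - m) * qfac Q (m + k)))
          + Q ^ m * (1 - Q ^ (M + 1 - m)) *
            (Q ^ (m * (m + k)) / (qfac Q m * qfac Q (M + 1 - m) * qfac Q (m + k))) := by
      intro m hm
      obtain ⟨d, hd⟩ := Nat.exists_eq_add_of_le (Nat.lt_succ_iff.mp (mem_range.mp hm))
      rw [hd, Nat.add_sub_cancel_left, pow_add]
      ring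
    rw [mul_sum, sum_congr rfl split, sum_add_distrib, sum_range_succ' _ (M + 1),
      sum_range_succ _ (M + 1)]
    simp only [pow_zero, Nat.sub_self, sub_self, zero_mul, add_zero, mul_zero]
    rw [← sum_add_distrib]
    have step : ∀ m ∈ range (M + 1),
        (1 - Q ^ (m + 1)) * (Q ^ ((m + 1) * (m + 1 + k)) /
            (qfac Q (m + 1) * qfac Q (M + 1 - (m + 1)) * qfac Q (m + 1 + k)))
          + Q ^ m * (1 - Q ^ (M + 1 - m)) *
            (Q ^ (m * (m + k)) / (qfac Q m * qfac Q (M + 1 - m) * qfac Q (m + k)))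
        = Q ^ (m * (m + (k + 1))) /
            (qfac Q m * qfac Q (M - m) * qfac Q (m + (k + 1))) := by
      intro m hm
      obtain ⟨d, rfl⟩ := Nat.exists_eq_add_of_le (Nat.lt_succ_iff.mp (mem_range.mp hm))
      have e1 : m + d + 1 - (m + 1) = d := by omega
      have e2 : m + d + 1 - m = d + 1 := by omega
      have e3 : m + d - m = d := by omega
      have e4 : m + 1 + k = m + k + 1 := by omega
      have e5 : m + (k + 1) = m + k + 1 := by omega
      rw [e1, e2, e3, e4, e5, qfac_succ Q m, qfac_succ Q d, qfac_succ Q (m + k)]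
      have h1 := qfac_ne_zero hQ m
      have h2 := qfac_ne_zero hQ d
      have h3 := qfac_ne_zero hQ (m + k)
      have h4 := one_sub_pow_ne_zero_of_norm_lt_one hQ m.succ_ne_zero
      have h5 := one_sub_pow_ne_zero_of_norm_lt_one hQ d.succ_ne_zero
      have h6 := one_sub_pow_ne_zero_of_norm_lt_one hQ (m + k).succ_ne_zero
      simp only [Nat.succ_eq_add_one] at h4 h5 h6
      have p1 : Q ^ ((m + 1) * (m + k + 1)) = Q ^ (m * (m + k)) * Q ^ m * Q ^ (m + k + 1) := by
        rw [← pow_add, ← pow_add]; congr 1; ring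
      have p2 : Q ^ (m * (m + k + 1)) = Q ^ (m * (m + k)) * Q ^ m := by
        rw [← pow_add]; congr 1
      rw [p1, p2]
      generalize Q ^ (m * (m + k)) = A at *
      generalize Q ^ (m + k + 1) = B at *
      generalize Q ^ (m + 1) = C at *
      generalize Q ^ (d + 1) = D at *
      generalize Q ^ m = E at *
      field_simp
      ring
    rw [sum_congr rfl step, ih (k + 1), qfac_succ Q M]
    have h1 := qfac_ne_zero hQ M
    have h2 := qfac_ne_zero hQ (M + 1 + k)
    have e : M + (k + 1) = M + 1 + k := by omega
    simp only [Nat.succ_eq_add_one] at hM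
    rw [e]
    field_simp

/-- Bailey's lemma for the parameter `a = Q = q ^ 2`, in finite form. -/
lemma finite_bailey {q : ℂ} (hQ : ‖q ^ 2‖ < 1) (e : ℕ → ℂ) (N : ℕ) :
    ∑ n ∈ range (N + 1), q ^ (2 * n * (n + 1)) *
        (∑ r ∈ range (n + 1), e r * (1 / (qfac (q ^ 2) (n - r) * qfac (q ^ 2) (n + r + 1)))) *
          (1 / qfac (q ^ 2) (N - n))
      = ∑ r ∈ range (N + 1), q ^ (2 * r * (r + 1)) * e r *
          (1 / (qfac (q ^ 2) (N - r) * qfac (q ^ 2) (N + r + 1))) := by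
  simp only [mul_sum, sum_mul]
  rw [sum_comm' (t' := range (N + 1)) (s' := fun r => Ico r (N + 1))
    (by intro x y; simp only [mem_range, mem_Ico]; omega)]
  refine sum_congr rfl fun r hr => ?_
  obtain ⟨d, rfl⟩ := Nat.exists_eq_add_of_le (Nat.lt_succ_iff.mp (mem_range.mp hr))
  rw [sum_Ico_eq_sum_range]
  have e1 : r + d + 1 - r = d + 1 := by omega
  have e2 : r + d - r = d := by omega
  have e3 : r + d + r + 1 = d + (2 * r + 1) := by omega
  rw [e1, e2, e3, ← sum_qfac_vandermonde hQ d (2 * r + 1), mul_sum]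
  refine sum_congr rfl fun m _ => ?_
  have e4 : r + m - r = m := by omega
  have e5 : r + m + r + 1 = m + (2 * r + 1) := by omega
  have e6 : r + d - (r + m) = d - m := by omega
  have p : q ^ (2 * (r + m) * (r + m + 1))
      = q ^ (2 * r * (r + 1)) * (q ^ 2) ^ (m * (m + (2 * r + 1))) := by
    rw [← pow_mul, ← pow_add]; congr 1; ring
  rw [e4, e5, e6, p]
  simp only [div_eq_mul_inv, mul_inv]
  ring

/-- The numerators of the partial fraction expansion. -/
noncomputable def pfNum (q : ℂ) (r : ℕ) : ℂ :=
  (-1) ^ r * q ^ (r * (r + 1)) * (1 - q ^ (4 * r + 2))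

lemma pfNum_step (q : ℂ) (r : ℕ) :
    (-1) ^ (r + 1) * q ^ ((r + 1) * (r + 1 + 1)) =
      -((-1) ^ r * q ^ (r * (r + 1))) * (q ^ (2 * r) * q ^ 2) := by
  have : q ^ ((r + 1) * (r + 1 + 1)) = q ^ (r * (r + 1)) * (q ^ (2 * r) * q ^ 2) := by
    rw [← pow_add, ← pow_add]; congr 1; ring
  rw [this, pow_succ]
  ring

/-- Partial sums of the telescoping sum behind `sum_pfNum_div_succ`. -/
lemma sum_pfNum_telescope {q : ℂ} (hq0 : q ≠ 0) (hQ : ‖q ^ 2‖ < 1) (n R : ℕ) (hR : R ≤ n) :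
    ∑ r ∈ range R, pfNum q r *
        (1 / (q ^ (2 * r) * qfac (q ^ 2) (n - r) * qfac (q ^ 2) (n + r + 1))) *
        (q ^ 2 * (1 - q ^ (4 * n)) * (1 - q ^ (4 * n + 2)) -
          (q ^ 2 - q ^ (2 * n)) * (1 - q ^ (2 * n + 2)) *
          ((1 - q ^ (2 * (n - r))) * (1 - q ^ (2 * (n + r + 1)))))
      = (-1) ^ R * q ^ (R * (R + 1)) * (1 - q ^ (2 * R)) * q ^ (2 * n + 2) *
          (q ^ (2 * R) * (q ^ (2 * n) - q ^ 2)
            - (1 - q ^ (2 * n + 2)) * (1 + q ^ (2 * R) + q ^ (4 * R))) /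
          (q ^ (4 * R) * qfac (q ^ 2) (n - R) * qfac (q ^ 2) (n + R)) := by
  induction R with
  | zero => simp
  | succ R ih =>
    rw [sum_range_succ, ih (by omega)]
    obtain ⟨d, rfl⟩ := Nat.exists_eq_add_of_le hR
    have e1 : R + 1 + d - R = d + 1 := by omega
    have e2 : R + 1 + d - (R + 1) = d := by omega
    have e3 : R + 1 + d + (R + 1) = R + 1 + d + R + 1 := by omega
    rw [e1, e2, e3, pfNum_step, pfNum, qfac_succ _ d, qfac_succ _ (R + 1 + d + R)]
    have h1 := qfac_ne_zero hQ d
    have h2 := qfac_ne_zero hQ (R + 1 + d + R)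
    have h3 := one_sub_pow_ne_zero_of_norm_lt_one hQ d.succ_ne_zero
    have h4 := one_sub_pow_ne_zero_of_norm_lt_one hQ (R + 1 + d + R).succ_ne_zero
    have h5 : q ^ R ≠ 0 := pow_ne_zero _ hq0
    simp only [Nat.succ_eq_add_one] at h3 h4
    have p1 : q ^ (2 * R) = (q ^ R) ^ 2 := by ring
    have p2 : q ^ (4 * R) = (q ^ R) ^ 4 := by ring
    have p3 : q ^ (4 * R + 2) = (q ^ R) ^ 4 * q ^ 2 := by ring
    have p4 : q ^ (2 * (R + 1 + d)) = (q ^ R) ^ 2 * q ^ 2 * (q ^ d) ^ 2 := by ring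
    have p5 : q ^ (4 * (R + 1 + d)) = (q ^ R) ^ 4 * q ^ 4 * (q ^ d) ^ 4 := by ring
    have p6 : q ^ (4 * (R + 1 + d) + 2) = (q ^ R) ^ 4 * q ^ 6 * (q ^ d) ^ 4 := by ring
    have p7 : q ^ (2 * (R + 1 + d) + 2) = (q ^ R) ^ 2 * q ^ 4 * (q ^ d) ^ 2 := by ring
    have p8 : q ^ (2 * (d + 1)) = (q ^ d) ^ 2 * q ^ 2 := by ring
    have p9 : q ^ (2 * (R + 1 + d + R + 1)) = (q ^ R) ^ 4 * (q ^ d) ^ 2 * q ^ 4 := by ring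
    have p10 : q ^ (2 * (R + 1)) = (q ^ R) ^ 2 * q ^ 2 := by ring
    have p11 : q ^ (4 * (R + 1)) = (q ^ R) ^ 4 * q ^ 4 := by ring
    have p12 : (q ^ 2) ^ (d + 1) = (q ^ d) ^ 2 * q ^ 2 := by ring
    have p13 : (q ^ 2) ^ (R + 1 + d + R + 1) = (q ^ R) ^ 4 * (q ^ d) ^ 2 * q ^ 4 := by ring
    rw [p12] at h3 ⊢
    rw [p13] at h4 ⊢
    rw [p1, p2, p3, p4, p5, p6, p7, p8, p9, p10, p11]
    generalize (-1) ^ R * q ^ (R * (R + 1)) = s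
    generalize qfac (q ^ 2) d = A at *
    generalize qfac (q ^ 2) (R + 1 + d + R) = B at *
    generalize q ^ R = x at *
    generalize q ^ d = y at *
    generalize hu : 1 - y ^ 2 * q ^ 2 = u at h3 ⊢
    generalize hv : 1 - x ^ 4 * y ^ 2 * q ^ 4 = v at h4 ⊢
    field_simp
    rw [← hu, ← hv]
    ring

lemma sum_pfNum_div_succ {q : ℂ} (hq0 : q ≠ 0) (hQ : ‖q ^ 2‖ < 1) (n : ℕ) :
    ∑ r ∈ range (n + 2), pfNum q r *
        (1 / (q ^ (2 * r) * qfac (q ^ 2) (n + 1 - r) * qfac (q ^ 2) (n + 1 + r + 1))) = 0 := by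
  have drop : ∀ n : ℕ, ∑ r ∈ range (n + 2), pfNum q r *
      (1 / (q ^ (2 * r) * qfac (q ^ 2) (n + 1 - r) * qfac (q ^ 2) (n + 1 + r + 1))) *
      ((1 - q ^ (2 * (n + 1 - r))) * (1 - q ^ (2 * (n + 1 + r + 1))))
      = ∑ r ∈ range (n + 1), pfNum q r *
        (1 / (q ^ (2 * r) * qfac (q ^ 2) (n - r) * qfac (q ^ 2) (n + r + 1))) := by
    intro n
    rw [sum_range_succ]
    simp only [Nat.sub_self, mul_zero, pow_zero, sub_self, zero_mul, add_zero]
    refine sum_congr rfl fun r hr => ?_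
    obtain ⟨d, rfl⟩ := Nat.exists_eq_add_of_le (Nat.lt_succ_iff.mp (mem_range.mp hr))
    have e1 : r + d + 1 - r = d + 1 := by omega
    have e2 : r + d - r = d := by omega
    have e3 : r + d + 1 + r + 1 = r + d + r + 1 + 1 := by omega
    rw [e1, e2, e3, qfac_succ _ d, qfac_succ _ (r + d + r + 1), pow_mul q 2, pow_mul q 2]
    have h3 := one_sub_pow_ne_zero_of_norm_lt_one hQ d.succ_ne_zero
    have h4 := one_sub_pow_ne_zero_of_norm_lt_one hQ (r + d + r + 1).succ_ne_zero
    simp only [Nat.succ_eq_add_one, pow_mul] at h3 h4 ⊢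
    field_simp
  have recurrence : ∀ n : ℕ, q ^ 2 * (1 - q ^ (4 * (n + 1))) * (1 - q ^ (4 * (n + 1) + 2)) *
      ∑ r ∈ range (n + 2), pfNum q r *
        (1 / (q ^ (2 * r) * qfac (q ^ 2) (n + 1 - r) * qfac (q ^ 2) (n + 1 + r + 1)))
      = (q ^ 2 - q ^ (2 * (n + 1))) * (1 - q ^ (2 * (n + 1) + 2)) *
        ∑ r ∈ range (n + 1), pfNum q r *
        (1 / (q ^ (2 * r) * qfac (q ^ 2) (n - r) * qfac (q ^ 2) (n + r + 1))) := by
    intro n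
    rw [← drop n, ← sub_eq_zero, mul_sum, mul_sum, ← sum_sub_distrib, sum_range_succ]
    have key := sum_pfNum_telescope hq0 hQ (n + 1) (n + 1) le_rfl
    rw [sum_congr rfl (g := fun r => pfNum q r *
        (1 / (q ^ (2 * r) * qfac (q ^ 2) (n + 1 - r) * qfac (q ^ 2) (n + 1 + r + 1))) *
        (q ^ 2 * (1 - q ^ (4 * (n + 1))) * (1 - q ^ (4 * (n + 1) + 2)) -
          (q ^ 2 - q ^ (2 * (n + 1))) * (1 - q ^ (2 * (n + 1) + 2)) *
          ((1 - q ^ (2 * (n + 1 - r))) * (1 - q ^ (2 * (n + 1 + r + 1))))))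
      (fun r _ => by ring), key]
    generalize n + 1 = m
    rw [pfNum, Nat.sub_self, qfac_succ _ (m + m), qfac_zero]
    have h2 := qfac_ne_zero hQ (m + m)
    have h4 := one_sub_pow_ne_zero_of_norm_lt_one hQ (m + m).succ_ne_zero
    have h5 : q ^ m ≠ 0 := pow_ne_zero _ hq0
    have p1 : q ^ (2 * m) = (q ^ m) ^ 2 := by ring
    have p2 : q ^ (4 * m) = (q ^ m) ^ 4 := by ring
    have p3 : q ^ (4 * m + 2) = (q ^ m) ^ 4 * q ^ 2 := by ring
    have p4 : q ^ (2 * m + 2) = (q ^ m) ^ 2 * q ^ 2 := by ring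
    have p5 : (q ^ 2) ^ (m + m + 1) = (q ^ m) ^ 4 * q ^ 2 := by ring
    simp only [Nat.succ_eq_add_one] at h4
    rw [p5] at h4 ⊢
    rw [p1, p2, p3, p4, mul_zero, pow_zero]
    generalize q ^ m = x at *
    field_simp
    ring
  have cancel : ∀ n : ℕ, q ^ 2 * (1 - q ^ (4 * (n + 1))) * (1 - q ^ (4 * (n + 1) + 2)) ≠ 0 := by
    intro n
    have h1 := one_sub_pow_ne_zero_of_norm_lt_one hQ (n := 2 * (n + 1)) (by omega)
    have h2 := one_sub_pow_ne_zero_of_norm_lt_one hQ (n := 2 * (n + 1) + 1) (by omega)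
    rw [← pow_mul] at h1 h2
    refine mul_ne_zero (mul_ne_zero (pow_ne_zero _ hq0) ?_) ?_
    · convert h1 using 3; ring
    · convert h2 using 3; ring
  induction n with
  | zero =>
    have h := recurrence 0
    rw [zero_add, mul_one, sub_self, zero_mul, zero_mul] at h
    exact (mul_eq_zero.mp h).resolve_left (cancel 0)
  | succ n ih =>
    have h := recurrence (n + 1)
    rw [ih, mul_zero] at h
    exact (mul_eq_zero.mp h).resolve_left (cancel (n + 1))

/-- Partial fractions for `1 / ∏ (1 - c y_k + y_k ^ 2)` with `y_k = q ^ (2 k + 1)`. -/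
lemma partial_fractions {q c : ℂ} (hq0 : q ≠ 0) (hQ : ‖q ^ 2‖ < 1)
    (hD : ∀ r : ℕ, 1 - c * q ^ (2 * r + 1) + q ^ (4 * r + 2) ≠ 0) (n : ℕ) :
    ∑ r ∈ range (n + 1), pfNum q r / (1 - c * q ^ (2 * r + 1) + q ^ (4 * r + 2)) *
        (1 / (qfac (q ^ 2) (n - r) * qfac (q ^ 2) (n + r + 1)))
      = ∏ k ∈ range (n + 1), (1 / (1 - c * q ^ (2 * k + 1) + q ^ (4 * k + 2))) := by
  induction n with
  | zero =>
    have h := one_sub_pow_ne_zero_of_norm_lt_one hQ one_ne_zero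
    simp only [pow_one] at h
    simp [pfNum, qfac_zero, qfac_succ]
    field_simp
  | succ n ih =>
    rw [prod_range_succ, ← ih, mul_one_div, eq_div_iff (hD _), sum_mul]
    have split : ∀ r ∈ range (n + 2),
        pfNum q r / (1 - c * q ^ (2 * r + 1) + q ^ (4 * r + 2)) *
        (1 / (qfac (q ^ 2) (n + 1 - r) * qfac (q ^ 2) (n + 1 + r + 1))) *
          (1 - c * q ^ (2 * (n + 1) + 1) + q ^ (4 * (n + 1) + 2))
        = q ^ (2 * (n + 1)) * (pfNum q r *
        (1 / (q ^ (2 * r) * qfac (q ^ 2) (n + 1 - r) * qfac (q ^ 2) (n + 1 + r + 1)))) +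
          pfNum q r / (1 - c * q ^ (2 * r + 1) + q ^ (4 * r + 2)) *
        (1 / (qfac (q ^ 2) (n + 1 - r) * qfac (q ^ 2) (n + 1 + r + 1))) *
          ((1 - (q ^ 2) ^ (n + 1 - r)) * (1 - (q ^ 2) ^ (n + 1 + r + 1))) := by
      intro r hr
      obtain ⟨d, hd⟩ := Nat.exists_eq_add_of_le (Nat.lt_succ_iff.mp (mem_range.mp hr))
      rw [hd, Nat.add_sub_cancel_left]
      have h1 := qfac_ne_zero hQ d
      have h2 := qfac_ne_zero hQ (r + d + r + 1)
      have h3 := hD r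
      have h5 : q ^ r ≠ 0 := pow_ne_zero _ hq0
      have p1 : q ^ (2 * r) = (q ^ r) ^ 2 := by ring
      have p2 : q ^ (2 * r + 1) = (q ^ r) ^ 2 * q := by ring
      have p3 : q ^ (4 * r + 2) = (q ^ r) ^ 4 * q ^ 2 := by ring
      have p4 : q ^ (2 * (r + d)) = (q ^ r) ^ 2 * (q ^ d) ^ 2 := by ring
      have p5 : q ^ (2 * (r + d) + 1) = (q ^ r) ^ 2 * (q ^ d) ^ 2 * q := by ring
      have p6 : q ^ (4 * (r + d) + 2) = (q ^ r) ^ 4 * (q ^ d) ^ 4 * q ^ 2 := by ring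
      have p7 : (q ^ 2) ^ d = (q ^ d) ^ 2 := by ring
      have p8 : (q ^ 2) ^ (r + d + r + 1) = (q ^ r) ^ 4 * (q ^ d) ^ 2 * q ^ 2 := by ring
      rw [p2, p3] at h3
      rw [p1, p2, p3, p4, p5, p6, p7, p8]
      generalize pfNum q r = s
      generalize qfac (q ^ 2) d = A at *
      generalize qfac (q ^ 2) (r + d + r + 1) = B at *
      generalize q ^ r = x at *
      generalize q ^ d = y at *
      generalize hE : 1 - c * (x ^ 2 * q) + x ^ 4 * q ^ 2 = E at h3 ⊢
      field_simp
      rw [← hE]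
      ring
    rw [sum_congr rfl split, sum_add_distrib, ← mul_sum, sum_pfNum_div_succ hq0 hQ, mul_zero,
      zero_add, sum_range_succ]
    simp only [Nat.sub_self, pow_zero, sub_self, zero_mul, mul_zero, add_zero]
    refine sum_congr rfl fun r hr => ?_
    obtain ⟨d, rfl⟩ := Nat.exists_eq_add_of_le (Nat.lt_succ_iff.mp (mem_range.mp hr))
    have e1 : r + d + 1 - r = d + 1 := by omega
    have e2 : r + d - r = d := by omega
    have e3 : r + d + 1 + r + 1 = r + d + r + 1 + 1 := by omega
    rw [e1, e2, e3, qfac_succ _ d, qfac_succ _ (r + d + r + 1)]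
    have h3 := one_sub_pow_ne_zero_of_norm_lt_one hQ d.succ_ne_zero
    have h4 := one_sub_pow_ne_zero_of_norm_lt_one hQ (r + d + r + 1).succ_ne_zero
    simp only [Nat.succ_eq_add_one] at h3 h4
    generalize pfNum q r / (1 - c * q ^ (2 * r + 1) + q ^ (4 * r + 2)) = s
    field_simp

lemma exists_norm_one_div_le_of_tendsto {u : ℕ → ℂ} {L : ℂ} (hL : L ≠ 0)
    (hu : Tendsto u atTop (𝓝 L)) : ∃ C, ∀ n, ‖1 / u n‖ ≤ C := by
  obtain ⟨C, hC⟩ := (Metric.isBounded_range_of_tendsto _ (hu.inv₀ hL)).exists_norm_le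
  exact ⟨C, fun n => by simpa using hC _ ⟨n, rfl⟩⟩

lemma tendsto_sum_range_mul {u : ℕ → ℂ} (hu : Summable fun r => ‖u r‖) {w : ℕ → ℕ → ℂ}
    {B : ℝ} (hB : ∀ N r, ‖w N r‖ ≤ B) {L : ℂ}
    (hw : ∀ r, Tendsto (fun N => w N r) atTop (𝓝 L)) :
    Tendsto (fun N => ∑ r ∈ range (N + 1), u r * w N r) atTop (𝓝 ((∑' r, u r) * L)) := by
  rw [← tsum_mul_right]
  have h : ∀ N, ∑ r ∈ range (N + 1), u r * w N r
      = ∑' r, (if r ∈ range (N + 1) then u r * w N r else 0) := by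
    intro N
    rw [tsum_eq_sum (s := range (N + 1)) (fun r hr => if_neg hr)]
    exact sum_congr rfl fun r hr => (if_pos hr).symm
  simp only [h]
  refine tendsto_tsum_of_dominated_convergence (bound := fun r => ‖u r‖ * B)
    (hu.mul_right B) (fun r => ?_) (Eventually.of_forall fun N r => ?_)
  · refine ((hw r).const_mul (u r)).congr' ?_
    filter_upwards [eventually_ge_atTop r] with N hN
    rw [if_pos (mem_range.mpr (by omega))]
  · split_ifs
    · rw [norm_mul]
      exact mul_le_mul_of_nonneg_left (hB N r) (norm_nonneg _)
    · rw [norm_zero]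
      exact mul_nonneg (norm_nonneg _) ((norm_nonneg _).trans (hB 0 0))

lemma summable_norm_pow_mul {q : ℂ} (hq : ‖q‖ < 1) {f : ℕ → ℕ} (hf : ∀ n, n ≤ f n)
    {b : ℕ → ℂ} {C : ℝ} (hb : ∀ n, ‖b n‖ ≤ C) : Summable fun n => ‖q ^ f n * b n‖ := by
  refine Summable.of_nonneg_of_le (fun _ => norm_nonneg _) (fun n => ?_)
    ((summable_geometric_of_lt_one (norm_nonneg q) hq).mul_right C)
  rw [norm_mul, norm_pow]
  exact mul_le_mul (pow_le_pow_of_le_one (norm_nonneg q) hq.le (hf n)) (hb n)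
    (norm_nonneg _) (pow_nonneg (norm_nonneg q) n)

lemma summable_norm_neg_mul_pow (a : ℂ) {Q : ℂ} (hQ : ‖Q‖ < 1) :
    Summable fun n : ℕ => ‖-(a * Q ^ n)‖ := by
  simp only [norm_neg, norm_mul, norm_pow]
  exact (summable_geometric_of_lt_one (norm_nonneg Q) hQ).mul_left _

lemma tendsto_pochN (a : ℂ) {Q : ℂ} (hQ : ‖Q‖ < 1) :
    Tendsto (pochN a Q) atTop (𝓝 (poch a Q)) := by
  have h := (multipliable_one_add_of_summable
    (summable_norm_neg_mul_pow a hQ)).hasProd.tendsto_prod_nat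
  simp only [← sub_eq_add_neg] at h
  exact h

lemma poch_ne_zero {a Q : ℂ} (hQ : ‖Q‖ < 1) (h : ∀ n : ℕ, 1 - a * Q ^ n ≠ 0) :
    poch a Q ≠ 0 := by
  have := tprod_one_add_ne_zero_of_summable (f := fun n : ℕ => -(a * Q ^ n))
    (fun n => by simpa only [← sub_eq_add_neg] using h n) (summable_norm_neg_mul_pow a hQ)
  simp only [← sub_eq_add_neg] at this
  exact this

lemma poch_self_ne_zero {Q : ℂ} (hQ : ‖Q‖ < 1) : poch Q Q ≠ 0 :=
  poch_ne_zero hQ fun n => by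
    rw [← pow_succ']
    exact one_sub_pow_ne_zero_of_norm_lt_one hQ n.succ_ne_zero

lemma norm_pow_lt_one {q : ℂ} (hq : ‖q‖ < 1) {n : ℕ} (hn : n ≠ 0) : ‖q ^ n‖ < 1 := by
  rw [norm_pow]
  exact pow_lt_one₀ (norm_nonneg q) hq hn

lemma poch_sq_ne_zero {q : ℂ} (hq : ‖q‖ < 1) : poch q (q ^ 2) ≠ 0 :=
  poch_ne_zero (norm_pow_lt_one hq two_ne_zero) fun n => by
    rw [← pow_mul, ← pow_succ']
    exact one_sub_pow_ne_zero_of_norm_lt_one hq (by omega)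

lemma tendsto_qfac {Q : ℂ} (hQ : ‖Q‖ < 1) : Tendsto (qfac Q) atTop (𝓝 (poch Q Q)) :=
  tendsto_pochN Q hQ

lemma exists_norm_one_div_qfac_le {Q : ℂ} (hQ : ‖Q‖ < 1) : ∃ C, ∀ n, ‖1 / qfac Q n‖ ≤ C :=
  exists_norm_one_div_le_of_tendsto (poch_self_ne_zero hQ) (tendsto_qfac hQ)

lemma exists_norm_one_div_qfac_mul_le {Q : ℂ} (hQ : ‖Q‖ < 1) :
    ∃ C, ∀ n m, ‖1 / (qfac Q n * qfac Q m)‖ ≤ C := by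
  obtain ⟨C, hC⟩ := exists_norm_one_div_qfac_le hQ
  refine ⟨C * C, fun n m => ?_⟩
  rw [← one_div_mul_one_div, norm_mul]
  exact mul_le_mul (hC n) (hC m) (norm_nonneg _) ((norm_nonneg _).trans (hC n))

lemma tendsto_one_div_qfac_sub {Q : ℂ} (hQ : ‖Q‖ < 1) (r : ℕ) :
    Tendsto (fun N => 1 / qfac Q (N - r)) atTop (𝓝 (1 / poch Q Q)) :=
  tendsto_const_nhds.div ((tendsto_qfac hQ).comp (tendsto_sub_atTop_nat r))
    (poch_self_ne_zero hQ)

lemma tendsto_one_div_qfac_mul {Q : ℂ} (hQ : ‖Q‖ < 1) (r : ℕ) :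
    Tendsto (fun N => 1 / (qfac Q (N - r) * qfac Q (N + r + 1))) atTop
      (𝓝 (1 / (poch Q Q * poch Q Q))) :=
  tendsto_const_nhds.div
    (((tendsto_qfac hQ).comp (tendsto_sub_atTop_nat r)).mul
      ((tendsto_qfac hQ).comp (tendsto_add_atTop_nat (r + 1))))
    (mul_ne_zero (poch_self_ne_zero hQ) (poch_self_ne_zero hQ))

/-- Bailey's lemma for the parameter `a = Q = q ^ 2`. -/
lemma bailey_limit {q : ℂ} (hq : ‖q‖ < 1) {e β : ℕ → ℂ}
    (hβ : ∀ n, ∑ r ∈ range (n + 1),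
      e r * (1 / (qfac (q ^ 2) (n - r) * qfac (q ^ 2) (n + r + 1))) = β n)
    {B C : ℝ} (hB : ∀ n, ‖β n‖ ≤ B) (hC : ∀ n, ‖e n‖ ≤ C) :
    poch (q ^ 2) (q ^ 2) * ∑' n, q ^ (2 * n * (n + 1)) * β n
      = ∑' r, q ^ (2 * r * (r + 1)) * e r := by
  have hQ := norm_pow_lt_one hq two_ne_zero
  have hexp : ∀ n, n ≤ 2 * n * (n + 1) := fun n => by nlinarith
  obtain ⟨K, hK⟩ := exists_norm_one_div_qfac_le hQ
  obtain ⟨K', hK'⟩ := exists_norm_one_div_qfac_mul_le hQ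
  have h1 := tendsto_sum_range_mul (summable_norm_pow_mul hq hexp hB)
    (w := fun N n => 1 / qfac (q ^ 2) (N - n)) (fun N n => hK _) (tendsto_one_div_qfac_sub hQ)
  have h2 := tendsto_sum_range_mul (summable_norm_pow_mul hq hexp hC)
    (w := fun N r => 1 / (qfac (q ^ 2) (N - r) * qfac (q ^ 2) (N + r + 1)))
    (fun N r => hK' _ _) (tendsto_one_div_qfac_mul hQ)
  have h := finite_bailey hQ e
  simp only [hβ] at h
  simp only [h] at h1
  have h3 := tendsto_nhds_unique h1 h2
  have hP := poch_self_ne_zero hQ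
  field_simp at h3
  linear_combination h3

lemma exists_norm_pfNum_factor_le {q : ℂ} (hq : ‖q‖ < 1) (c : ℂ) :
    ∃ C, ∀ r : ℕ, ‖(-1) ^ r * (1 - q ^ (4 * r + 2)) /
      (1 - c * q ^ (2 * r + 1) + q ^ (4 * r + 2))‖ ≤ C := by
  have h0 := tendsto_pow_atTop_nhds_zero_of_norm_lt_one hq
  have h1 : Tendsto (fun r : ℕ => q ^ (2 * r + 1)) atTop (𝓝 0) :=
    h0.comp (tendsto_atTop_mono (fun r => by simp only [id]; omega) tendsto_id)
  have h2 : Tendsto (fun r : ℕ => q ^ (4 * r + 2)) atTop (𝓝 0) :=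
    h0.comp (tendsto_atTop_mono (fun r => by simp only [id]; omega) tendsto_id)
  have hD : Tendsto (fun r : ℕ => 1 - c * q ^ (2 * r + 1) + q ^ (4 * r + 2)) atTop (𝓝 1) := by
    simpa using ((h1.const_mul c).const_sub 1).add h2
  obtain ⟨C, hC⟩ := exists_norm_one_div_le_of_tendsto one_ne_zero hD
  refine ⟨2 * C, fun r => ?_⟩
  rw [← mul_one_div, norm_mul]
  refine mul_le_mul ?_ (hC r) (norm_nonneg _) zero_le_two
  rw [norm_mul, norm_pow, norm_neg, norm_one, one_pow, one_mul]
  refine (norm_sub_le _ _).trans ?_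
  have := (norm_pow_lt_one hq (n := 4 * r + 2) (by omega)).le
  rw [norm_one]
  linarith

lemma pfNum_div_eq (q c : ℂ) (r : ℕ) :
    pfNum q r / (1 - c * q ^ (2 * r + 1) + q ^ (4 * r + 2))
      = q ^ (r * (r + 1)) * ((-1) ^ r * (1 - q ^ (4 * r + 2)) /
      (1 - c * q ^ (2 * r + 1) + q ^ (4 * r + 2))) := by
  rw [pfNum]
  ring

lemma exists_norm_pfNum_div_le {q : ℂ} (hq : ‖q‖ < 1) (c : ℂ) :
    ∃ C, ∀ r : ℕ, ‖pfNum q r / (1 - c * q ^ (2 * r + 1) + q ^ (4 * r + 2))‖ ≤ C := by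
  obtain ⟨C, hC⟩ := exists_norm_pfNum_factor_le hq c
  refine ⟨1 * C, fun r => ?_⟩
  rw [pfNum_div_eq, norm_mul]
  refine mul_le_mul ?_ (hC r) (norm_nonneg _) zero_le_one
  rw [norm_pow]
  exact pow_le_one₀ (norm_nonneg q) hq.le

lemma one_sub_two_mul_add (q : ℂ) (r : ℕ) :
    1 - 2 * q ^ (2 * r + 1) + q ^ (4 * r + 2) = (1 - q ^ (2 * r + 1)) ^ 2 := by ring

lemma one_sub_two_mul_add_ne_zero {q : ℂ} (hq : ‖q‖ < 1) (r : ℕ) :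
    1 - 2 * q ^ (2 * r + 1) + q ^ (4 * r + 2) ≠ 0 := by
  rw [one_sub_two_mul_add]
  exact pow_ne_zero _ (one_sub_pow_ne_zero_of_norm_lt_one hq (by omega))

lemma one_sub_mul_one_add_add (q : ℂ) (r : ℕ) :
    (1 - q ^ (2 * r + 1)) * (1 - -1 * q ^ (2 * r + 1) + q ^ (4 * r + 2))
      = 1 - q ^ (6 * r + 3) := by ring

lemma one_add_add_ne_zero {q : ℂ} (hq : ‖q‖ < 1) (r : ℕ) :
    1 - -1 * q ^ (2 * r + 1) + q ^ (4 * r + 2) ≠ 0 := by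
  refine right_ne_zero_of_mul (a := 1 - q ^ (2 * r + 1)) ?_
  rw [one_sub_mul_one_add_add]
  exact one_sub_pow_ne_zero_of_norm_lt_one hq (by omega)

lemma prod_one_div_two (q : ℂ) (n : ℕ) :
    ∏ k ∈ range n, (1 / (1 - 2 * q ^ (2 * k + 1) + q ^ (4 * k + 2)))
      = 1 / pochN q (q ^ 2) n ^ 2 := by
  rw [pochN, ← prod_pow, prod_div_distrib, prod_const_one]
  congr 1
  refine prod_congr rfl fun k _ => ?_
  rw [one_sub_two_mul_add, ← pow_mul, ← pow_succ']

lemma prod_one_div_neg_one {q : ℂ} (hq : ‖q‖ < 1) (n : ℕ) :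
    ∏ k ∈ range n, (1 / (1 - -1 * q ^ (2 * k + 1) + q ^ (4 * k + 2)))
      = pochN q (q ^ 2) n / pochN (q ^ 3) (q ^ 6) n := by
  rw [pochN, pochN, ← prod_div_distrib]
  refine prod_congr rfl fun k _ => ?_
  have h1 : 1 - q * (q ^ 2) ^ k = 1 - q ^ (2 * k + 1) := by ring
  have h2 : 1 - q ^ 3 * (q ^ 6) ^ k = 1 - q ^ (6 * k + 3) := by ring
  rw [h1, h2, ← one_sub_mul_one_add_add]
  have := one_sub_pow_ne_zero_of_norm_lt_one hq (n := 2 * k + 1) (by omega)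
  have := one_add_add_ne_zero hq k
  field_simp

/-- The partial fraction expansion of a reciprocal theta function at a half period. -/
lemma tsum_pfNum_div {q : ℂ} (hq0 : q ≠ 0) (hq : ‖q‖ < 1) :
    ∑' r, pfNum q r / (1 - 2 * q ^ (2 * r + 1) + q ^ (4 * r + 2))
      = poch (q ^ 2) (q ^ 2) ^ 2 / poch q (q ^ 2) ^ 2 := by
  have hQ := norm_pow_lt_one hq two_ne_zero
  obtain ⟨K, hK⟩ := exists_norm_one_div_qfac_mul_le hQ
  obtain ⟨C, hC⟩ := exists_norm_pfNum_factor_le hq 2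
  have hs := summable_norm_pow_mul hq (f := fun r => r * (r + 1)) (fun r => by nlinarith) hC
  simp only [← pfNum_div_eq] at hs
  have h1 := tendsto_sum_range_mul hs
    (w := fun N r => 1 / (qfac (q ^ 2) (N - r) * qfac (q ^ 2) (N + r + 1)))
    (fun N r => hK _ _) (tendsto_one_div_qfac_mul hQ)
  simp only [partial_fractions hq0 hQ (one_sub_two_mul_add_ne_zero hq), prod_one_div_two] at h1
  have hne := poch_sq_ne_zero hq
  have h2 : Tendsto (fun n => 1 / pochN q (q ^ 2) (n + 1) ^ 2) atTop
      (𝓝 (1 / poch q (q ^ 2) ^ 2)) :=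
    tendsto_const_nhds.div
      (((tendsto_pochN q hQ).comp (tendsto_add_atTop_nat 1)).pow 2) (pow_ne_zero 2 hne)
  have h3 := tendsto_nhds_unique h1 h2
  have hP := poch_self_ne_zero hQ
  field_simp at h3 ⊢
  linear_combination h3

lemma omega3_eq_tsum {q : ℂ} (hq0 : q ≠ 0) (hq : ‖q‖ < 1) :
    poch (q ^ 2) (q ^ 2) * omega3 q = ∑' r, q ^ (2 * r * (r + 1)) *
      (pfNum q r / (1 - 2 * q ^ (2 * r + 1) + q ^ (4 * r + 2))) := by
  have hQ := norm_pow_lt_one hq two_ne_zero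
  obtain ⟨C, hC⟩ := exists_norm_pfNum_div_le hq 2
  obtain ⟨B, hB⟩ := exists_norm_one_div_le_of_tendsto
    (pow_ne_zero 2 (poch_sq_ne_zero hq)) ((tendsto_pochN q hQ).pow 2)
  have h := bailey_limit hq (β := fun n => 1 / pochN q (q ^ 2) (n + 1) ^ 2)
    (fun n => (partial_fractions hq0 hQ (one_sub_two_mul_add_ne_zero hq) n).trans
      (prod_one_div_two q (n + 1))) (fun n => hB (n + 1)) hC
  simpa only [omega3, mul_one_div] using h

lemma rho3_eq_tsum {q : ℂ} (hq0 : q ≠ 0) (hq : ‖q‖ < 1) :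
    poch (q ^ 2) (q ^ 2) * rho3 q = ∑' r, q ^ (2 * r * (r + 1)) *
      (pfNum q r / (1 - -1 * q ^ (2 * r + 1) + q ^ (4 * r + 2))) := by
  have hQ := norm_pow_lt_one hq two_ne_zero
  have hq3 := norm_pow_lt_one hq three_ne_zero
  obtain ⟨C, hC⟩ := exists_norm_pfNum_div_le hq (-1)
  have hne : poch (q ^ 3) (q ^ 6) ≠ 0 := by
    simpa only [← pow_mul] using poch_sq_ne_zero hq3
  obtain ⟨B, hB⟩ := exists_norm_one_div_le_of_tendsto
    (div_ne_zero hne (poch_sq_ne_zero hq))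
    ((tendsto_pochN (q ^ 3) (norm_pow_lt_one hq (n := 6) (by norm_num))).div
      (tendsto_pochN q hQ) (poch_sq_ne_zero hq))
  have h := bailey_limit hq
    (β := fun n => pochN q (q ^ 2) (n + 1) / pochN (q ^ 3) (q ^ 6) (n + 1))
    (fun n => (partial_fractions hq0 hQ (one_add_add_ne_zero hq) n).trans
      (prod_one_div_neg_one hq (n + 1)))
    (fun n => by simpa only [Pi.div_apply, one_div_div] using hB (n + 1)) hC
  simpa only [rho3, mul_div_assoc] using h

lemma pfNum_cube_roots {q : ℂ} (hq : ‖q‖ < 1) (r : ℕ) :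
    q ^ (2 * r * (r + 1)) * (pfNum q r / (1 - 2 * q ^ (2 * r + 1) + q ^ (4 * r + 2)))
      + 2 * (q ^ (2 * r * (r + 1)) *
        (pfNum q r / (1 - -1 * q ^ (2 * r + 1) + q ^ (4 * r + 2))))
      = 3 * (pfNum (q ^ 3) r /
        (1 - 2 * (q ^ 3) ^ (2 * r + 1) + (q ^ 3) ^ (4 * r + 2))) := by
  have h1 := one_sub_pow_ne_zero_of_norm_lt_one hq (n := 2 * r + 1) (by omega)
  have h2 := one_add_add_ne_zero hq r
  have e : (q ^ 3) ^ (r * (r + 1)) = q ^ (2 * r * (r + 1)) * q ^ (r * (r + 1)) := by ring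
  have e1 : (q ^ 3) ^ (2 * r + 1) = 1 - (1 - q ^ (2 * r + 1)) *
      (1 - -1 * q ^ (2 * r + 1) + q ^ (4 * r + 2)) := by ring
  have e2 : (q ^ 3) ^ (4 * r + 2) = ((q ^ 3) ^ (2 * r + 1)) ^ 2 := by ring
  have e3 : q ^ (4 * r + 2) = (q ^ (2 * r + 1)) ^ 2 := by ring
  rw [one_sub_two_mul_add, one_sub_two_mul_add, pfNum, pfNum, e, e2, e1]
  rw [e3] at h2 ⊢
  generalize q ^ (2 * r * (r + 1)) = s
  generalize q ^ (r * (r + 1)) = t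
  generalize q ^ (2 * r + 1) = y at *
  generalize hu : 1 - -1 * y + y ^ 2 = u at h2 ⊢
  generalize hv : 1 - y = v at h1 ⊢
  rw [sub_sub_cancel]
  field_simp
  rw [← hu, ← hv]
  ring

theorem stmt19 (q : ℂ) (hq0 : 0 < ‖q‖) (hq : ‖q‖ < 1) :
    omega3 q + 2 * rho3 q = 3 * (Jm 6 q) ^ 3 / (Jm 2 q * Jam 3 6 q) := by
  have hq' : q ≠ 0 := norm_pos_iff.mp hq0
  have hq3 := norm_pow_lt_one hq three_ne_zero
  have hexp : ∀ n, n ≤ 2 * n * (n + 1) := fun n => by nlinarith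
  obtain ⟨C, hC⟩ := exists_norm_pfNum_div_le hq 2
  obtain ⟨C', hC'⟩ := exists_norm_pfNum_div_le hq (-1)
  have key : poch (q ^ 2) (q ^ 2) * (omega3 q + 2 * rho3 q)
      = 3 * (poch (q ^ 6) (q ^ 6) ^ 2 / poch (q ^ 3) (q ^ 6) ^ 2) := by
    have h := tsum_pfNum_div (pow_ne_zero 3 hq') hq3
    simp only [← pow_mul q 3 2, Nat.reduceMul] at h
    rw [mul_add, mul_left_comm, omega3_eq_tsum hq' hq, rho3_eq_tsum hq' hq, ← tsum_mul_left,
      ← (summable_norm_pow_mul hq hexp hC).of_norm.tsum_add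
        ((summable_norm_pow_mul hq hexp hC').of_norm.mul_left 2), ← h, ← tsum_mul_left]
    exact tsum_congr (pfNum_cube_roots hq)
  have h2 : poch (q ^ 2) (q ^ 2) ≠ 0 := poch_self_ne_zero (norm_pow_lt_one hq two_ne_zero)
  have h6 : poch (q ^ 6) (q ^ 6) ≠ 0 :=
    poch_self_ne_zero (norm_pow_lt_one hq (by norm_num))
  have h3 : poch (q ^ 3) (q ^ 6) ≠ 0 := by
    simpa only [← pow_mul] using poch_sq_ne_zero hq3
  rw [Jm, Jm, Jam]
  simp only [Nat.reduceSub]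
  field_simp at key ⊢
  linear_combination key
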